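/- arXiv:1706.09145 — 2 statements merged into one kernel-verified Lean document; each statement's English description precedes it below -/
import Mathlib

section
/- Let D ⊆ ℂ be open and f : D → ℂ holomorphic with nowhere vanishing derivative, and let a ∈ D and b, c, d ∈ ℂ be such that a, b, c, d are pairwise distinct. Then lim_{ε→0} ε^{−2} · ( cr( f(a), f(a+ε(b−a)), f(a+ε(c−a)), f(a+ε(d−a)) ) / cr(a,b,c,d) − 1 ) = ((a−c)(b−d)/6) · 𝔖[f](a). -/
open Complex

noncomputable section

/-- The cross-ratio of four points in the complex plane. -/
def cr (a b c d : ℂ) : ℂ := (a - b) * (c - d) / ((b - c) * (d - a))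

/-- The Schwarzian derivative 𝔖[f] = (f''/f')' − (1/2)(f''/f')². -/
def schwarzian (f : ℂ → ℂ) (z : ℂ) : ℂ :=
  deriv (fun w => deriv (deriv f) w / deriv f w) z
    - (1 / 2) * (deriv (deriv f) z / deriv f z) ^ 2

open Filter Topology

/-- Taylor expansion of order three at `a`, normalised by the derivative. -/
lemma AnalyticAt.exists_cubic_expansion {f : ℂ → ℂ} {a : ℂ} (hf : AnalyticAt ℂ f a)
    (hf' : deriv f a ≠ 0) :
    ∃ F : ℂ → ℂ, ContinuousAt F 0 ∧ ∀ z, f (a + z) = f a + deriv f a * (z +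
      deriv (deriv f) a / (2 * deriv f a) * z ^ 2 +
      deriv (deriv (deriv f)) a / (6 * deriv f a) * z ^ 3 + z ^ 4 * F z) := by
  have hshift : AnalyticAt ℂ (fun z => f (a + z)) 0 := by
    refine AnalyticAt.fun_comp (g := f) (by simpa using hf) (by fun_prop)
  obtain ⟨F, hF, h⟩ := hshift.exists_eq_sum_add_pow_mul 4
  refine ⟨fun z => F z / deriv f a, hF.continuousAt.div_const _, fun z => ?_⟩
  rw [h z]
  simp only [Finset.sum_range_succ, Finset.sum_range_zero, iteratedDeriv_comp_const_add,
    iteratedDeriv_succ, iteratedDeriv_zero, Nat.factorial, smul_eq_mul, add_zero]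
  field_simp
  push_cast
  ring

lemma schwarzian_eq_of_analyticAt {f : ℂ → ℂ} {a : ℂ} (hf : AnalyticAt ℂ f a)
    (hf' : deriv f a ≠ 0) :
    schwarzian f a = 6 * (deriv (deriv (deriv f)) a / (6 * deriv f a)
      - (deriv (deriv f) a / (2 * deriv f a)) ^ 2) := by
  rw [schwarzian, deriv_fun_div hf.deriv.deriv.differentiableAt hf.deriv.differentiableAt hf']
  field_simp
  ring

/-- The second-order part of the difference of the cross-multiplied cross-ratios of `0, b, c, d`
and of `0, b + ε * u₁, c + ε * u₂, d + ε * u₃`, where `uᵢ = p * x ^ 2 + ε * vᵢ` with `x` the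
corresponding point. -/
def crossRatioDefect (p b c d v₁ v₂ v₃ ε : ℂ) : ℂ :=
  v₁ * (c - d) * (b - c) * d + b * (v₂ - v₃) * (b - c) * d - b * (c - d) * (v₁ - v₂) * d
    - b * (c - d) * (b - c) * v₃
    + (p * b ^ 2 + ε * v₁) * ((p * c ^ 2 + ε * v₂) - (p * d ^ 2 + ε * v₃)) * (b - c) * d
    - b * (c - d) * ((p * b ^ 2 + ε * v₁) - (p * c ^ 2 + ε * v₂)) * (p * d ^ 2 + ε * v₃)

lemma cross_ratio_defect {k ε p b c d v₁ v₂ v₃ B C D : ℂ} (hk : k ≠ 0) (hε : ε ≠ 0)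
    (hb : b ≠ 0) (hd : d ≠ 0) (hbc : b - c ≠ 0) (hcd : c - d ≠ 0)
    (hB : B = b + ε * (p * b ^ 2 + ε * v₁)) (hC : C = c + ε * (p * c ^ 2 + ε * v₂))
    (hD : D = d + ε * (p * d ^ 2 + ε * v₃)) (hBC : B - C ≠ 0) (hD₀ : D ≠ 0) :
    (ε ^ 2)⁻¹ * ((-(k * (ε * B)) * (k * (ε * C) - k * (ε * D)) /
        ((k * (ε * B) - k * (ε * C)) * (k * (ε * D)))) /
        (-b * (c - d) / ((b - c) * d)) - 1) =
      crossRatioDefect p b c d v₁ v₂ v₃ ε / (b * (c - d) * ((B - C) * D)) := by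
  have hratio : (-(k * (ε * B)) * (k * (ε * C) - k * (ε * D)) /
        ((k * (ε * B) - k * (ε * C)) * (k * (ε * D)))) /
        (-b * (c - d) / ((b - c) * d)) =
      B * (C - D) * ((b - c) * d) / (b * (c - d) * ((B - C) * D)) := by
    rw [← mul_sub, ← mul_sub, ← mul_sub, ← mul_sub]
    field_simp
  rw [hratio, div_sub_one (mul_ne_zero (mul_ne_zero hb hcd) (mul_ne_zero hBC hD₀)), ← mul_div_assoc]
  congr 1
  rw [inv_mul_eq_iff_eq_mul₀ (by simpa), crossRatioDefect, hB, hC, hD]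
  ring

/-- For a conformal map `f` on an open set `D` and pairwise distinct
points `a, b, c, d` with `a ∈ D`,
`lim_{ε→0} ε⁻² (cr(f a, f(a+ε(b−a)), f(a+ε(c−a)), f(a+ε(d−a))) / cr(a,b,c,d) − 1)
  = ((a−c)(b−d)/6) 𝔖[f](a)`. -/
theorem cross_ratio_limit_schwarzian
    (D : Set ℂ) (hD : IsOpen D) (f : ℂ → ℂ)
    (hf : DifferentiableOn ℂ f D) (hf' : ∀ z ∈ D, deriv f z ≠ 0)
    (a b c d : ℂ) (ha : a ∈ D)
    (hab : a ≠ b) (hac : a ≠ c) (had : a ≠ d)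
    (hbc : b ≠ c) (hbd : b ≠ d) (hcd : c ≠ d) :
    Filter.Tendsto
      (fun ε : ℝ =>
        ((ε : ℂ) ^ 2)⁻¹ *
          (cr (f a) (f (a + (ε : ℂ) * (b - a))) (f (a + (ε : ℂ) * (c - a)))
              (f (a + (ε : ℂ) * (d - a))) / cr a b c d - 1))
      (nhdsWithin 0 {0}ᶜ)
      (nhds ((a - c) * (b - d) / 6 * schwarzian f a)) := by
  have hfa : AnalyticAt ℂ f a := hf.analyticAt (hD.mem_nhds ha)
  have hk := hf' a ha
  obtain ⟨F, hF, hexp⟩ := hfa.exists_cubic_expansion hk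
  rw [schwarzian_eq_of_analyticAt hfa hk]
  set k := deriv f a
  set p := deriv (deriv f) a / (2 * k)
  set q := deriv (deriv (deriv f)) a / (6 * k)
  let v (x : ℂ) (ε : ℂ) : ℂ := x ^ 3 * (q + ε * x * F (ε * x))
  let X (x : ℂ) (ε : ℂ) : ℂ := x + ε * (p * x ^ 2 + ε * v x ε)
  have hX (x : ℂ) (ε : ℂ) : f (a + ε * x) = f a + k * (ε * X x ε) := by
    rw [hexp]
    ring
  have hv (x : ℂ) : ContinuousAt (v x) 0 := by
    have : ContinuousAt (fun ε : ℂ => F (ε * x)) 0 :=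
      ContinuousAt.comp' (g := F) (by simpa using hF) (by fun_prop)
    exact continuousAt_const.mul (continuousAt_const.add (ContinuousAt.mul (by fun_prop) this))
  have hXc (x : ℂ) : ContinuousAt (X x) 0 := by
    have := hv x
    change ContinuousAt (fun ε : ℂ => x + ε * (p * x ^ 2 + ε * v x ε)) 0
    fun_prop
  have hb : b - a ≠ 0 := sub_ne_zero.2 hab.symm
  have hd : d - a ≠ 0 := sub_ne_zero.2 had.symm
  have hbc' : (b - a) - (c - a) ≠ 0 := by simpa [sub_eq_zero] using hbc
  have hcd' : (c - a) - (d - a) ≠ 0 := by simpa [sub_eq_zero] using hcd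
  have hcr : cr a b c d =
      -(b - a) * ((c - a) - (d - a)) / (((b - a) - (c - a)) * (d - a)) := by
    simp [cr]
  rw [hcr]
  have hBC : ∀ᶠ ε : ℂ in 𝓝 0, X (b - a) ε - X (c - a) ε ≠ 0 :=
    ((hXc _).sub (hXc _)).eventually_ne (by simpa [X] using hbc')
  have hD₀ : ∀ᶠ ε : ℂ in 𝓝 0, X (d - a) ε ≠ 0 :=
    (hXc _).eventually_ne (by simpa [X] using hd)
  have hcr_image (ε : ℂ) : cr (f a) (f (a + ε * (b - a))) (f (a + ε * (c - a)))
      (f (a + ε * (d - a))) =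
      -(k * (ε * X (b - a) ε)) * (k * (ε * X (c - a) ε) - k * (ε * X (d - a) ε)) /
        ((k * (ε * X (b - a) ε) - k * (ε * X (c - a) ε)) * (k * (ε * X (d - a) ε))) := by
    simp [cr, hX]
  have hofReal : Tendsto (fun ε : ℝ => (ε : ℂ)) (𝓝[≠] 0) (𝓝[≠] 0) :=
    (Complex.continuous_ofReal.tendsto' 0 0 rfl).inf (by simp)
  refine Tendsto.comp (g := fun ε : ℂ => (ε ^ 2)⁻¹ * (cr (f a) (f (a + ε * (b - a)))
    (f (a + ε * (c - a))) (f (a + ε * (d - a))) / _ - 1)) ?_ hofReal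
  simp only [hcr_image]
  refine Tendsto.congr' (f₁ := fun ε =>
    crossRatioDefect p (b - a) (c - a) (d - a) (v (b - a) ε) (v (c - a) ε) (v (d - a) ε) ε /
    ((b - a) * ((c - a) - (d - a)) * ((X (b - a) ε - X (c - a) ε) * X (d - a) ε))) ?_
    (Tendsto.mono_left ?_ nhdsWithin_le_nhds)
  · filter_upwards [nhdsWithin_le_nhds hBC, nhdsWithin_le_nhds hD₀, self_mem_nhdsWithin]
      with ε hBC hD₀ hε
    exact (cross_ratio_defect hk hε hb hd hbc' hcd' rfl rfl rfl hBC hD₀).symm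
  have hvb := hv (b - a)
  have hvc := hv (c - a)
  have hvd := hv (d - a)
  have hXb := hXc (b - a)
  have hXc' := hXc (c - a)
  have hXd := hXc (d - a)
  have hden : (b - a) * ((c - a) - (d - a)) *
      ((X (b - a) 0 - X (c - a) 0) * X (d - a) 0) ≠ 0 := by
    simp [X, sub_eq_zero, hab.symm, had.symm, hbc, hcd]
  have hnum_cont : ContinuousAt (fun ε => crossRatioDefect p (b - a) (c - a) (d - a)
      (v (b - a) ε) (v (c - a) ε) (v (d - a) ε) ε) 0 := by
    unfold crossRatioDefect
    fun_prop
  have hden_cont : ContinuousAt (fun ε => (b - a) * ((c - a) - (d - a)) *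
      ((X (b - a) ε - X (c - a) ε) * X (d - a) ε)) 0 := by
    fun_prop
  convert! (hnum_cont.div hden_cont hden).tendsto using 2
  rw [Pi.div_apply, eq_div_iff hden]
  simp only [crossRatioDefect, X, v, zero_mul, add_zero]
  ring
end
end

section
/- Let w₀, w₁, …, w₆ ∈ ℂ (indices of w₁,…,w₆ taken modulo 6) satisfy w₀ ≠ w_j for all j = 1,…,6 and w_j ≠ w_{j+1} for all j. Set q_k = cr(w₀, w_{k−1}, w_k, w_{k+1}) for k = 1,…,6. Then for every k ∈ {1,…,6} (indices modulo 6): 1 − q_k + q_k q_{k+1} − q_k q_{k+1} q_{k+2} + q_k q_{k+1} q_{k+2} q_{k+3} − q_k q_{k+1} q_{k+2} q_{k+3} q_{k+4} = 0. -/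
open Complex

noncomputable section

/-- Sending `a` to infinity turns the cross-ratio into a quotient of differences. -/
theorem cr_eq_neg_div_inv_sub {a b c d : ℂ} (hb : a ≠ b) (hc : a ≠ c) (hd : a ≠ d)
    (hbc : b ≠ c) :
    cr a b c d =
      -(((d - a)⁻¹ - (c - a)⁻¹) / ((c - a)⁻¹ - (b - a)⁻¹)) := by
  have hb' : b - a ≠ 0 := sub_ne_zero.2 hb.symm
  have hc' : c - a ≠ 0 := sub_ne_zero.2 hc.symm
  have hd' : d - a ≠ 0 := sub_ne_zero.2 hd.symm
  have hbc' : b - c ≠ 0 := sub_ne_zero.2 hbc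
  have h₁ : (d - a)⁻¹ - (c - a)⁻¹ = (c - d) / ((d - a) * (c - a)) := by
    field_simp
    ring
  have h₂ : (c - a)⁻¹ - (b - a)⁻¹ = (b - c) / ((c - a) * (b - a)) := by
    field_simp
    ring
  rw [cr, h₁, h₂]
  field_simp
  ring

/-- For a flower `w₀; w₁, …, w₆` (indices of the petals mod 6) with
`w₀ ≠ w_j` and `w_j ≠ w_{j+1}`, the cross-ratios `q_k = cr(w₀, w_{k−1}, w_k, w_{k+1})`
satisfy, for every `k` (indices mod 6),
`1 − q_k + q_k q_{k+1} − q_k q_{k+1} q_{k+2} + q_k q_{k+1} q_{k+2} q_{k+3}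
  − q_k q_{k+1} q_{k+2} q_{k+3} q_{k+4} = 0`. -/
theorem flower_cross_ratio_alternating
    (w₀ : ℂ) (w : ZMod 6 → ℂ)
    (h0 : ∀ j : ZMod 6, w₀ ≠ w j) (h1 : ∀ j : ZMod 6, w j ≠ w (j + 1))
    (q : ZMod 6 → ℂ)
    (hq : ∀ k : ZMod 6, q k = cr w₀ (w (k - 1)) (w k) (w (k + 1))) :
    ∀ k : ZMod 6,
      1 - q k + q k * q (k + 1) - q k * q (k + 1) * q (k + 2)
        + q k * q (k + 1) * q (k + 2) * q (k + 3)
        - q k * q (k + 1) * q (k + 2) * q (k + 3) * q (k + 4) = 0 := by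
  intro k
  have hu : ∀ j, (w (j + 1) - w₀)⁻¹ - (w j - w₀)⁻¹ ≠ 0 := fun j h =>
    h1 j (sub_left_injective (inv_injective (sub_eq_zero.1 h))).symm
  have hq' : ∀ j, q (j + 1) = -(((w (j + 2) - w₀)⁻¹ - (w (j + 1) - w₀)⁻¹) /
      ((w (j + 1) - w₀)⁻¹ - (w j - w₀)⁻¹)) := fun j => by
    rw [hq, add_sub_cancel_right, add_assoc, one_add_one_eq_two,
      cr_eq_neg_div_inv_sub (h0 _) (h0 _) (h0 _) (h1 j)]
  obtain ⟨j, rfl⟩ : ∃ j, k = j + 1 := ⟨k - 1, by ring⟩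
  have e0 := hu j
  have e1 := hu (j + 1)
  have e2 := hu (j + 2)
  have e3 := hu (j + 3)
  have e4 := hu (j + 4)
  have p0 := hq' j
  have p1 := hq' (j + 1)
  have p2 := hq' (j + 2)
  have p3 := hq' (j + 3)
  have p4 := hq' (j + 4)
  have h6 : j + (4 + 2) = j := by
    rw [show (4 + 2 : ZMod 6) = 0 from rfl, add_zero]
  simp only [add_assoc] at e0 e1 e2 e3 e4 p0 p1 p2 p3 p4 ⊢
  rw [h6] at p4
  norm_num only at e0 e1 e2 e3 e4 p0 p1 p2 p3 p4 ⊢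
  rw [p0, p1, p2, p3, p4]
  generalize (w j - w₀)⁻¹ = u₀ at *
  generalize (w (j + 1) - w₀)⁻¹ = u₁ at *
  generalize (w (j + 2) - w₀)⁻¹ = u₂ at *
  generalize (w (j + 3) - w₀)⁻¹ = u₃ at *
  generalize (w (j + 4) - w₀)⁻¹ = u₄ at *
  generalize (w (j + 5) - w₀)⁻¹ = u₅ at *
  field_simp
  ring
end
end
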